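/- arXiv:1009.5975 — 5 statements merged into one kernel-verified Lean document; each statement's English description precedes it below -/
import Mathlib

section
/- Let L ≥ 1 and let P_in : {1,…,L} → ℝ be nonnegative. Let P_tr be a causality-feasible power allocation, let 1 ≤ e < s ≤ L, and let c = (1/(s−e+1))·∑_{i=e}^{s} P_tr(i) be the average of P_tr over the segment {e,…,s}. Define P'_tr by P'_tr(i) = c for i ∈ {e,…,s} and P'_tr(i) = P_tr(i) for i ∉ {e,…,s}. If P'_tr is also causality-feasible and P'_tr ≠ P_tr (equivalently, P_tr is not constant on {e,…,s}), then ∑_{i=1}^L (1/2)·log(1 + P'_tr(i)) > ∑_{i=1}^L (1/2)·log(1 + P_tr(i)). -/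
/-- A power allocation `Ptr` on slots `{1, …, L}` is causality-feasible w.r.t.
the recharge vector `Pin` if it is nonnegative and the cumulative transmitted
energy never exceeds the cumulative arrived energy. -/
def CausalityFeasible (L : ℕ) (Pin Ptr : ℕ → ℝ) : Prop :=
  (∀ i ∈ Finset.Icc 1 L, 0 ≤ Ptr i) ∧
    ∀ l ∈ Finset.Icc 1 L, ∑ i ∈ Finset.Icc 1 l, Ptr i ≤ ∑ i ∈ Finset.Icc 1 l, Pin i

/-- The tangent line of `log` at `b` lies strictly above `log` away from `b`. -/
theorem Real.log_lt_log_add_sub_div {a b : ℝ} (ha : 0 < a) (hb : 0 < b) (hab : a ≠ b) :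
    Real.log a < Real.log b + (a - b) / b := by
  have h := Real.log_lt_sub_one_of_pos (div_pos ha hb) (by rwa [Ne, div_eq_one_iff_eq hb.ne'])
  rw [Real.log_div ha.ne' hb.ne'] at h
  rw [sub_div, div_self hb.ne']
  linarith

/-- Strict Jensen inequality for `log` with equal weights: replacing positive reals, not all
equal to `b`, by their average `b` strictly increases the sum of logarithms. -/
theorem Finset.sum_log_lt_sum_log_of_sum_eq {ι : Type*} {t : Finset ι} {f : ι → ℝ} {b : ℝ}
    (hf : ∀ i ∈ t, 0 < f i) (hb : 0 < b) (hsum : ∑ i ∈ t, f i = ∑ _i ∈ t, b)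
    (hne : ∃ i ∈ t, f i ≠ b) :
    ∑ i ∈ t, Real.log (f i) < ∑ _i ∈ t, Real.log b := by
  have htangent : ∑ i ∈ t, (Real.log b + (f i - b) / b) = ∑ _i ∈ t, Real.log b := by
    rw [Finset.sum_add_distrib, ← Finset.sum_div, Finset.sum_sub_distrib, hsum, sub_self,
      zero_div, add_zero]
  rw [← htangent]
  refine Finset.sum_lt_sum (fun i hi => ?_) ?_
  · rcases eq_or_ne (f i) b with h | h
    · simp [h]
    · exact (Real.log_lt_log_add_sub_div (hf i hi) hb h).le
  · obtain ⟨i, hi, h⟩ := hne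
    exact ⟨i, hi, Real.log_lt_log_add_sub_div (hf i hi) hb h⟩

/-- **Averaging a segment strictly improves throughput (Theorem 3 of the paper).**
Let `Ptr` be a causality-feasible allocation, let `1 ≤ e < s ≤ L`, and let `c`
be the average of `Ptr` over the segment `{e, …, s}`. Define `Ptr'` by replacing
`Ptr` with the constant `c` on `{e, …, s}` and leaving it unchanged elsewhere.
If `Ptr'` is also causality-feasible and `Ptr` is not constant on the segment
(so `Ptr' ≠ Ptr`), then `Ptr'` achieves strictly larger total throughput. -/
theorem segment_averaging_strictly_improves_throughput
    (L : ℕ) (hL : 1 ≤ L) (Pin : ℕ → ℝ)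
    (hPin : ∀ i ∈ Finset.Icc 1 L, 0 ≤ Pin i)
    (Ptr : ℕ → ℝ) (hPtr : CausalityFeasible L Pin Ptr)
    (e s : ℕ) (he : 1 ≤ e) (hes : e < s) (hsL : s ≤ L)
    (c : ℝ) (hc : c = (∑ i ∈ Finset.Icc e s, Ptr i) / ((s : ℝ) - (e : ℝ) + 1))
    (Ptr' : ℕ → ℝ)
    (hPtr'def : ∀ i, Ptr' i = if i ∈ Finset.Icc e s then c else Ptr i)
    (hPtr' : CausalityFeasible L Pin Ptr')
    (hne : ∃ i ∈ Finset.Icc e s, Ptr i ≠ c) :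
    ∑ i ∈ Finset.Icc 1 L, (1 / 2 : ℝ) * Real.log (1 + Ptr i)
      < ∑ i ∈ Finset.Icc 1 L, (1 / 2 : ℝ) * Real.log (1 + Ptr' i) := by
  have hsub : Finset.Icc e s ⊆ Finset.Icc 1 L := Finset.Icc_subset_Icc he hsL
  have hc_nonneg : 0 ≤ c := by
    have hmem : e ∈ Finset.Icc e s := Finset.left_mem_Icc.2 hes.le
    simpa [hPtr'def e, hmem] using hPtr'.1 e (hsub hmem)
  have hlen : (0 : ℝ) < (s : ℝ) - e + 1 := by
    have : (e : ℝ) < s := by exact_mod_cast hes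
    linarith
  have hcard : ((Finset.Icc e s).card : ℝ) = (s : ℝ) - e + 1 := by
    rw [Nat.card_Icc, Nat.cast_sub (by omega)]
    push_cast
    ring
  have hsum : ∑ i ∈ Finset.Icc e s, Ptr i = ∑ _i ∈ Finset.Icc e s, c := by
    rw [Finset.sum_const, nsmul_eq_mul, hcard, hc, mul_div_cancel₀ _ hlen.ne']
  have hseg : ∑ i ∈ Finset.Icc e s, Real.log (1 + Ptr i)
      < ∑ i ∈ Finset.Icc e s, Real.log (1 + Ptr' i) := by
    have hin : ∑ i ∈ Finset.Icc e s, Real.log (1 + Ptr' i)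
        = ∑ _i ∈ Finset.Icc e s, Real.log (1 + c) :=
      Finset.sum_congr rfl fun i hi => by rw [hPtr'def i, if_pos hi]
    rw [hin]
    refine Finset.sum_log_lt_sum_log_of_sum_eq (fun i hi => ?_) (by linarith) ?_ ?_
    · have := hPtr.1 i (hsub hi)
      linarith
    · rw [Finset.sum_add_distrib, Finset.sum_add_distrib, hsum]
    · obtain ⟨i, hi, h⟩ := hne
      exact ⟨i, hi, fun heq => h (add_left_cancel heq)⟩
  have hout : ∑ i ∈ Finset.Icc 1 L \ Finset.Icc e s, Real.log (1 + Ptr' i)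
      = ∑ i ∈ Finset.Icc 1 L \ Finset.Icc e s, Real.log (1 + Ptr i) :=
    Finset.sum_congr rfl fun i hi => by
      rw [hPtr'def i, if_neg (Finset.mem_sdiff.1 hi).2]
  rw [← Finset.mul_sum, ← Finset.mul_sum, ← Finset.sum_sdiff hsub,
    ← Finset.sum_sdiff (f := fun i => Real.log (1 + Ptr' i)) hsub, hout]
  linarith
end

section
/- Let L ≥ 1 and let P_in : {1,…,L} → ℝ be nonnegative. The greedy minimum-slope power allocation P* is causality-feasible: P*(i) ≥ 0 for all i, and ∑_{i=1}^ℓ P*(i) ≤ ∑_{i=1}^ℓ P_in(i) for every ℓ = 1,…,L. -/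
/-- Cumulative energy: `cumE Pin k = ∑_{j=1}^k Pin j` (with `cumE Pin 0 = 0`). -/
noncomputable def cumE (Pin : ℕ → ℝ) (k : ℕ) : ℝ :=
  ∑ j ∈ Finset.Icc 1 k, Pin j

/-- `GreedySpec L Pin K n Pstar` says that `n 0 = 0 < n 1 < ⋯ < n K = L` are the
breakpoints of the greedy minimum-slope construction with cumulative energy
`cumE Pin`, and `Pstar` is the resulting power allocation: for each `k < K`,
`n (k+1)` is the **largest** minimizer over `m ∈ {n k + 1, …, L}` of the slope
`(e m − e (n k)) / (m − n k)`, and `Pstar i` equals that minimal slope for every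
`i ∈ {n k + 1, …, n (k+1)}`. -/
def GreedySpec (L : ℕ) (Pin : ℕ → ℝ) (K : ℕ) (n : ℕ → ℕ) (Pstar : ℕ → ℝ) : Prop :=
  n 0 = 0 ∧ n K = L ∧
  ∀ k < K,
    n k < n (k + 1) ∧ n (k + 1) ≤ L ∧
    (∀ m ∈ Finset.Icc (n k + 1) L,
      (cumE Pin (n (k + 1)) - cumE Pin (n k)) / ((n (k + 1) : ℝ) - (n k : ℝ))
        ≤ (cumE Pin m - cumE Pin (n k)) / ((m : ℝ) - (n k : ℝ))) ∧
    (∀ m ∈ Finset.Icc (n k + 1) L,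
      (cumE Pin m - cumE Pin (n k)) / ((m : ℝ) - (n k : ℝ))
        = (cumE Pin (n (k + 1)) - cumE Pin (n k)) / ((n (k + 1) : ℝ) - (n k : ℝ)) →
        m ≤ n (k + 1)) ∧
    (∀ i ∈ Finset.Icc (n k + 1) (n (k + 1)),
      Pstar i = (cumE Pin (n (k + 1)) - cumE Pin (n k)) / ((n (k + 1) : ℝ) - (n k : ℝ)))

/-- If an allocation equals a constant `c` on the slots `{a + 1, …, b}`, its cumulative energy is
affine with slope `c` there. -/
theorem cumE_eq_add_mul_of_eq_const {P : ℕ → ℝ} {a b l : ℕ} {c : ℝ}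
    (hc : ∀ i ∈ Finset.Icc (a + 1) b, P i = c) (hal : a ≤ l) (hlb : l ≤ b) :
    cumE P l = cumE P a + c * ((l : ℝ) - a) := by
  induction l, hal using Nat.le_induction with
  | base => simp
  | succ l hal ih =>
    have hstep : cumE P (l + 1) = cumE P l + P (l + 1) :=
      Finset.sum_Icc_succ_top (by omega) P
    rw [hstep, ih (by omega), hc (l + 1) (Finset.mem_Icc.mpr ⟨by omega, hlb⟩)]
    push_cast
    ring

/-- The cumulative energy of a nonnegative recharge vector is monotone. -/
theorem cumE_le_cumE {L : ℕ} {P : ℕ → ℝ} (hP : ∀ i ∈ Finset.Icc 1 L, 0 ≤ P i)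
    {a b : ℕ} (hab : a ≤ b) (hbL : b ≤ L) : cumE P a ≤ cumE P b :=
  Finset.sum_le_sum_of_subset_of_nonneg (Finset.Icc_subset_Icc_right hab)
    fun i hi _ => hP i (Finset.Icc_subset_Icc_right hbL hi)

/-- Up to each breakpoint `n k`, the greedy allocation is nonnegative and respects the cumulative
constraints, and it exhausts the arrived energy at `n k`. -/
theorem GreedySpec.feasible_upto_breakpoint {L : ℕ} {Pin : ℕ → ℝ} {K : ℕ} {n : ℕ → ℕ}
    {Pstar : ℕ → ℝ} (h : GreedySpec L Pin K n Pstar)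
    (hPin : ∀ i ∈ Finset.Icc 1 L, 0 ≤ Pin i) {k : ℕ} (hk : k ≤ K) :
    (∀ i ∈ Finset.Icc 1 (n k), 0 ≤ Pstar i) ∧ (∀ l ≤ n k, cumE Pstar l ≤ cumE Pin l) ∧
      cumE Pstar (n k) = cumE Pin (n k) := by
  induction k with
  | zero => simp [h.1, cumE]
  | succ k ih =>
    obtain ⟨hnonneg, hle, heq⟩ := ih (by omega)
    obtain ⟨hlt, hL, hmin, -, hP⟩ := h.2.2 k hk
    have hpos : (0 : ℝ) < (n (k + 1) : ℝ) - n k := sub_pos.mpr (by exact_mod_cast hlt)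
    refine ⟨fun i hi => ?_, fun l hl => ?_, ?_⟩
    · rw [Finset.mem_Icc] at hi
      by_cases hik : i ≤ n k
      · exact hnonneg i (Finset.mem_Icc.mpr ⟨hi.1, hik⟩)
      · rw [hP i (Finset.mem_Icc.mpr ⟨by omega, hi.2⟩)]
        exact div_nonneg (sub_nonneg.mpr (cumE_le_cumE hPin hlt.le hL)) hpos.le
    · by_cases hlk : l ≤ n k
      · exact hle l hlk
      · have hslope := hmin l (Finset.mem_Icc.mpr ⟨by omega, by omega⟩)
        have hlpos : (0 : ℝ) < (l : ℝ) - n k :=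
          sub_pos.mpr (by exact_mod_cast not_le.mp hlk)
        rw [le_div_iff₀ hlpos] at hslope
        rw [cumE_eq_add_mul_of_eq_const hP (by omega) hl, heq]
        linarith
    · rw [cumE_eq_add_mul_of_eq_const hP hlt.le le_rfl, heq, div_mul_cancel₀ _ hpos.ne']
      ring

/-- **The greedy minimum-slope allocation is causality-feasible.**
For `L ≥ 1` and a nonnegative recharge vector `Pin`, the allocation `Pstar`
produced by the greedy minimum-slope recursion is nonnegative and satisfies
all the cumulative causality constraints `∑_{i=1}^ℓ Pstar i ≤ ∑_{i=1}^ℓ Pin i`. -/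
theorem greedy_allocation_causality_feasible
    (L : ℕ) (hL : 1 ≤ L) (Pin : ℕ → ℝ)
    (hPin : ∀ i ∈ Finset.Icc 1 L, 0 ≤ Pin i)
    (K : ℕ) (n : ℕ → ℕ) (Pstar : ℕ → ℝ)
    (hgreedy : GreedySpec L Pin K n Pstar) :
    CausalityFeasible L Pin Pstar := by
  obtain ⟨hnonneg, hle, -⟩ := hgreedy.feasible_upto_breakpoint hPin le_rfl
  rw [hgreedy.2.1] at hnonneg hle
  exact ⟨hnonneg, fun l hl => hle l (Finset.mem_Icc.mp hl).2⟩
end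

section
/- Let L ≥ 1 and let P_in : {1,…,L} → ℝ be nonnegative. The greedy minimum-slope power allocation P* is nondecreasing in time: P*(i) ≤ P*(j) whenever 1 ≤ i ≤ j ≤ L. Moreover, the slope values on consecutive segments of the construction are strictly increasing. -/
theorem div_lt_div_of_lt_mediant {x y p q : ℝ} (hp : 0 < p) (hq : 0 < q)
    (h : x / p < (x + y) / (p + q)) : x / p < y / q := by
  rw [div_lt_div_iff₀ hp (by positivity)] at h
  rw [div_lt_div_iff₀ hp hq]
  linarith

namespace GreedySpec

variable {L K : ℕ} {Pin Pstar : ℕ → ℝ} {n : ℕ → ℕ}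

theorem slope_lt_slope_succ (h : GreedySpec L Pin K n Pstar) {k : ℕ} (hk : k + 1 < K) :
    (cumE Pin (n (k + 1)) - cumE Pin (n k)) / ((n (k + 1) : ℝ) - (n k : ℝ))
      < (cumE Pin (n (k + 2)) - cumE Pin (n (k + 1))) /
          ((n (k + 2) : ℝ) - (n (k + 1) : ℝ)) := by
  obtain ⟨h₁, -, hmin, hmax, -⟩ := h.2.2 k (by lia)
  obtain ⟨h₂, hL, -⟩ := h.2.2 (k + 1) hk
  have hmem : n (k + 2) ∈ Finset.Icc (n k + 1) L := Finset.mem_Icc.2 ⟨by lia, hL⟩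
  refine div_lt_div_of_lt_mediant (sub_pos.2 (by exact_mod_cast h₁))
    (sub_pos.2 (by exact_mod_cast h₂)) ?_
  rw [sub_add_sub_cancel', sub_add_sub_cancel']
  exact (hmin _ hmem).lt_of_ne fun heq => (hmax _ hmem heq.symm).not_gt h₂

theorem slope_le_slope (h : GreedySpec L Pin K n Pstar) {k l : ℕ} (hkl : k ≤ l) (hl : l < K) :
    (cumE Pin (n (k + 1)) - cumE Pin (n k)) / ((n (k + 1) : ℝ) - (n k : ℝ))
      ≤ (cumE Pin (n (l + 1)) - cumE Pin (n l)) / ((n (l + 1) : ℝ) - (n l : ℝ)) := by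
  induction l, hkl using Nat.le_induction with
  | base => exact le_rfl
  | succ l _ ih => exact (ih (by lia)).trans (h.slope_lt_slope_succ hl).le

/-- The segment containing `i` ends at the first breakpoint that is at least `i`. -/
theorem exists_segment (h : GreedySpec L Pin K n Pstar) {i : ℕ} (hi : 1 ≤ i) (hiL : i ≤ L) :
    ∃ k < K, n k < i ∧ i ≤ n (k + 1) ∧ ∀ l, i ≤ n l → k + 1 ≤ l := by
  classical
  have hex : ∃ k, i ≤ n k := ⟨K, h.2.1.symm ▸ hiL⟩
  have hspec := Nat.find_spec hex
  have hle : ∀ l, i ≤ n l → Nat.find hex ≤ l := fun l hl => Nat.find_min' hex hl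
  have hK : Nat.find hex ≤ K := hle K (h.2.1.symm ▸ hiL)
  generalize Nat.find hex = m at hspec hle hK
  cases m with
  | zero =>
    rw [h.1] at hspec
    lia
  | succ k =>
    refine ⟨k, hK, ?_, hspec, hle⟩
    by_contra! hc
    exact absurd (hle k hc) (by lia)

theorem monotone (h : GreedySpec L Pin K n Pstar) {i j : ℕ} (hi : 1 ≤ i) (hij : i ≤ j)
    (hj : j ≤ L) : Pstar i ≤ Pstar j := by
  obtain ⟨k, hk, hki, hik, hkmin⟩ := h.exists_segment hi (hij.trans hj)
  obtain ⟨l, hl, hlj, hjl, -⟩ := h.exists_segment (hi.trans hij) hj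
  rw [(h.2.2 k hk).2.2.2.2 i (Finset.mem_Icc.2 ⟨hki, hik⟩),
    (h.2.2 l hl).2.2.2.2 j (Finset.mem_Icc.2 ⟨hlj, hjl⟩)]
  exact h.slope_le_slope (Nat.le_of_succ_le_succ (hkmin _ (hij.trans hjl))) hl

end GreedySpec

/-- **The greedy minimum-slope allocation is nondecreasing in time.**
For `L ≥ 1` and a nonnegative recharge vector `Pin`, the allocation `Pstar`
produced by the greedy minimum-slope recursion satisfies `Pstar i ≤ Pstar j`
whenever `1 ≤ i ≤ j ≤ L`; moreover, the slope values on consecutive segments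
of the construction are strictly increasing. -/
theorem greedy_allocation_monotone
    (L : ℕ) (hL : 1 ≤ L) (Pin : ℕ → ℝ)
    (hPin : ∀ i ∈ Finset.Icc 1 L, 0 ≤ Pin i)
    (K : ℕ) (n : ℕ → ℕ) (Pstar : ℕ → ℝ)
    (hgreedy : GreedySpec L Pin K n Pstar) :
    (∀ i j : ℕ, 1 ≤ i → i ≤ j → j ≤ L → Pstar i ≤ Pstar j) ∧
    (∀ k : ℕ, k + 1 < K →
      (cumE Pin (n (k + 1)) - cumE Pin (n k)) / ((n (k + 1) : ℝ) - (n k : ℝ))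
        < (cumE Pin (n (k + 2)) - cumE Pin (n (k + 1))) /
            ((n (k + 2) : ℝ) - (n (k + 1) : ℝ))) :=
  ⟨fun _ _ => hgreedy.monotone, fun _ => hgreedy.slope_lt_slope_succ⟩
end

section
/- Let L ≥ 1 and let P_in : {1,…,L} → ℝ be nonnegative. The greedy minimum-slope power allocation P* maximizes the total throughput over all causality-feasible allocations: for every causality-feasible power allocation P_tr, ∑_{i=1}^L (1/2)·log(1 + P_tr(i)) ≤ ∑_{i=1}^L (1/2)·log(1 + P*(i)). -/
/-- Tangent-line bound for the concave throughput function. -/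
lemma throughput_le_tangent {p s : ℝ} (hp : 0 ≤ p) (hs : 0 ≤ s) :
    (1 / 2 : ℝ) * Real.log (1 + p)
      ≤ (1 / 2 : ℝ) * Real.log (1 + s) + (p - s) * (1 / 2 / (1 + s)) := by
  have hp' : 0 < 1 + p := by linarith
  have hs' : 0 < 1 + s := by linarith
  have h := Real.log_le_sub_one_of_pos (div_pos hp' hs')
  rw [Real.log_div hp'.ne' hs'.ne'] at h
  have h2 : (p - s) * (1 / 2 / (1 + s)) = 1 / 2 * ((1 + p) / (1 + s) - 1) := by
    field_simp
    ring
  rw [h2]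
  linarith

lemma sum_Icc_one_eq_add_sum_Icc (f : ℕ → ℝ) {a b : ℕ} (hab : a ≤ b) :
    ∑ i ∈ Finset.Icc 1 b, f i
      = ∑ i ∈ Finset.Icc 1 a, f i + ∑ i ∈ Finset.Icc (a + 1) b, f i := by
  simpa only [← Finset.Icc_add_one_left_eq_Ioc, zero_add] using
    (Finset.sum_Ioc_consecutive f (Nat.zero_le a) hab).symm

/-- The slope of the `k`-th segment of the cumulative energy with breakpoints `n`. -/
noncomputable def segmentSlope (Pin : ℕ → ℝ) (n : ℕ → ℕ) (k : ℕ) : ℝ :=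
  (cumE Pin (n (k + 1)) - cumE Pin (n k)) / ((n (k + 1) : ℝ) - (n k : ℝ))

lemma segmentSlope_mul {Pin : ℕ → ℝ} {n : ℕ → ℕ} {k : ℕ} (h : n k < n (k + 1)) :
    segmentSlope Pin n k * ((n (k + 1) : ℝ) - (n k : ℝ))
      = cumE Pin (n (k + 1)) - cumE Pin (n k) := by
  have h' : (n k : ℝ) < n (k + 1) := by exact_mod_cast h
  exact div_mul_cancel₀ _ (by linarith)

namespace GreedySpec

variable {L : ℕ} {Pin : ℕ → ℝ} {K : ℕ} {n : ℕ → ℕ} {Pstar Ptr : ℕ → ℝ}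

lemma segmentSlope_nonneg (hg : GreedySpec L Pin K n Pstar)
    (hPin : ∀ i ∈ Finset.Icc 1 L, 0 ≤ Pin i) {k : ℕ} (hk : k < K) :
    0 ≤ segmentSlope Pin n k := by
  obtain ⟨hlt, hle, -⟩ := hg.2.2 k hk
  have h' : (n k : ℝ) < n (k + 1) := by exact_mod_cast hlt
  refine div_nonneg ?_ (by linarith)
  rw [cumE, cumE, sum_Icc_one_eq_add_sum_Icc Pin hlt.le, add_sub_cancel_left]
  refine Finset.sum_nonneg fun i hi => hPin i ?_
  rw [Finset.mem_Icc] at hi ⊢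
  lia

lemma segmentSlope_le_succ (hg : GreedySpec L Pin K n Pstar) {k : ℕ} (hk : k + 1 < K) :
    segmentSlope Pin n k ≤ segmentSlope Pin n (k + 1) := by
  obtain ⟨hlt, -, hmin, -⟩ := hg.2.2 k (by lia)
  obtain ⟨hlt', hle', -⟩ := hg.2.2 (k + 1) hk
  have h1 : (n k : ℝ) < n (k + 1) := by exact_mod_cast hlt
  have h2 : (n (k + 1) : ℝ) < n (k + 1 + 1) := by exact_mod_cast hlt'
  have h := hmin (n (k + 1 + 1)) (Finset.mem_Icc.2 (by lia))
  rw [le_div_iff₀ (by linarith)] at h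
  change segmentSlope Pin n k * _ ≤ _ at h
  have e1 := segmentSlope_mul (Pin := Pin) hlt
  have e2 := segmentSlope_mul (Pin := Pin) hlt'
  refine le_of_mul_le_mul_right ?_ (sub_pos.2 h2)
  linarith

/-- Within one greedy segment the throughput gain is controlled by the energy difference. -/
lemma sum_segment_le (hg : GreedySpec L Pin K n Pstar)
    (hPin : ∀ i ∈ Finset.Icc 1 L, 0 ≤ Pin i) (hPtr : ∀ i ∈ Finset.Icc 1 L, 0 ≤ Ptr i)
    {k : ℕ} (hk : k < K) :
    ∑ i ∈ Finset.Icc (n k + 1) (n (k + 1)), (1 / 2 : ℝ) * Real.log (1 + Ptr i)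
      ≤ ∑ i ∈ Finset.Icc (n k + 1) (n (k + 1)), (1 / 2 : ℝ) * Real.log (1 + Pstar i)
        + ((∑ i ∈ Finset.Icc (n k + 1) (n (k + 1)), Ptr i)
            - (cumE Pin (n (k + 1)) - cumE Pin (n k)))
          * (1 / 2 / (1 + segmentSlope Pin n k)) := by
  have hs := hg.segmentSlope_nonneg hPin hk
  obtain ⟨hlt, hle, -, -, hstar⟩ := hg.2.2 k hk
  have hsum : ∑ i ∈ Finset.Icc (n k + 1) (n (k + 1)), segmentSlope Pin n k
      = cumE Pin (n (k + 1)) - cumE Pin (n k) := by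
    rw [Finset.sum_const, Nat.card_Icc, Nat.add_sub_add_right, nsmul_eq_mul,
      Nat.cast_sub hlt.le, mul_comm, segmentSlope_mul hlt]
  rw [← hsum, ← Finset.sum_sub_distrib, Finset.sum_mul, ← Finset.sum_add_distrib]
  refine Finset.sum_le_sum fun i hi => ?_
  have hi' := Finset.mem_Icc.1 hi
  rw [hstar i hi]
  exact throughput_le_tangent (hPtr i (Finset.mem_Icc.2 (by lia))) hs

/-- Up to the end of the `k`-th segment, the throughput deficit dominates the unused energy
weighted by the marginal throughput on that segment. -/
lemma sum_throughput_le (hg : GreedySpec L Pin K n Pstar)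
    (hPin : ∀ i ∈ Finset.Icc 1 L, 0 ≤ Pin i) (hPtr : CausalityFeasible L Pin Ptr)
    {k : ℕ} (hk : k < K) :
    ∑ i ∈ Finset.Icc 1 (n (k + 1)), (1 / 2 : ℝ) * Real.log (1 + Ptr i)
      ≤ ∑ i ∈ Finset.Icc 1 (n (k + 1)), (1 / 2 : ℝ) * Real.log (1 + Pstar i)
        + (∑ i ∈ Finset.Icc 1 (n (k + 1)), Ptr i - cumE Pin (n (k + 1)))
          * (1 / 2 / (1 + segmentSlope Pin n k)) := by
  induction k with
  | zero =>
    have h := hg.sum_segment_le hPin hPtr.1 hk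
    simpa [hg.1, cumE] using h
  | succ k ih =>
    have h := hg.sum_segment_le hPin hPtr.1 hk
    have ih := ih (by lia)
    obtain ⟨hlt, hle, -⟩ := hg.2.2 k (by lia)
    have hlt' := (hg.2.2 (k + 1) hk).1
    have hD := hPtr.2 (n (k + 1)) (Finset.mem_Icc.2 (by lia))
    have hs := hg.segmentSlope_nonneg hPin (k := k) (by lia)
    have hw : 1 / 2 / (1 + segmentSlope Pin n (k + 1)) ≤ 1 / 2 / (1 + segmentSlope Pin n k) := by
      have := hg.segmentSlope_le_succ hk
      gcongr
    have hDw := mul_le_mul_of_nonpos_left hw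
      (show ∑ i ∈ Finset.Icc 1 (n (k + 1)), Ptr i - cumE Pin (n (k + 1)) ≤ 0 from
        sub_nonpos.2 hD)
    simp only [sum_Icc_one_eq_add_sum_Icc _ hlt'.le]
    linarith

end GreedySpec

/-- **Optimality of the greedy minimum-slope allocation.**
For `L ≥ 1` and a nonnegative recharge vector `Pin`, the allocation `Pstar`
produced by the greedy minimum-slope recursion maximizes the total throughput
`∑_{i=1}^L (1/2)·log(1 + ·)` over all causality-feasible power allocations. -/
theorem greedy_allocation_maximizes_throughput
    (L : ℕ) (hL : 1 ≤ L) (Pin : ℕ → ℝ)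
    (hPin : ∀ i ∈ Finset.Icc 1 L, 0 ≤ Pin i)
    (K : ℕ) (n : ℕ → ℕ) (Pstar : ℕ → ℝ)
    (hgreedy : GreedySpec L Pin K n Pstar)
    (Ptr : ℕ → ℝ) (hPtr : CausalityFeasible L Pin Ptr) :
    ∑ i ∈ Finset.Icc 1 L, (1 / 2 : ℝ) * Real.log (1 + Ptr i)
      ≤ ∑ i ∈ Finset.Icc 1 L, (1 / 2 : ℝ) * Real.log (1 + Pstar i) := by
  obtain ⟨h0, hK, -⟩ := id hgreedy
  obtain _ | k := K
  · lia
  have h := hgreedy.sum_throughput_le hPin hPtr k.lt_succ_self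
  have hs := hgreedy.segmentSlope_nonneg hPin k.lt_succ_self
  rw [hK] at h
  have hD := hPtr.2 L (Finset.mem_Icc.2 ⟨hL, le_rfl⟩)
  refine h.trans (add_le_of_nonpos_right (mul_nonpos_of_nonpos_of_nonneg (sub_nonpos.2 hD) ?_))
  positivity
end

section
/- Let L ≥ 1 and let P_in : {1,…,L} → ℝ be nonnegative with ∑_{i=1}^L P_in(i) > 0. Any causality-feasible power allocation P_tr that maximizes ∑_{i=1}^L (1/2)·log(1 + P_tr(i)) over all causality-feasible allocations must exhaust the total arriving energy: ∑_{i=1}^L P_tr(i) = ∑_{i=1}^L P_in(i). -/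
/-- **Every throughput maximizer exhausts the arriving energy.**
For `L ≥ 1` and a nonnegative recharge vector `Pin` with strictly positive
total energy, any causality-feasible allocation `Ptr` that maximizes the total
throughput `∑_{i=1}^L (1/2)·log(1 + ·)` over all causality-feasible allocations
satisfies `∑_{i=1}^L Ptr i = ∑_{i=1}^L Pin i`. -/
theorem throughput_maximizer_exhausts_energy
    (L : ℕ) (hL : 1 ≤ L) (Pin : ℕ → ℝ)
    (hPin : ∀ i ∈ Finset.Icc 1 L, 0 ≤ Pin i)
    (hPinpos : 0 < ∑ i ∈ Finset.Icc 1 L, Pin i)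
    (Ptr : ℕ → ℝ) (hPtr : CausalityFeasible L Pin Ptr)
    (hmax : ∀ Q : ℕ → ℝ, CausalityFeasible L Pin Q →
      ∑ i ∈ Finset.Icc 1 L, (1 / 2 : ℝ) * Real.log (1 + Q i)
        ≤ ∑ i ∈ Finset.Icc 1 L, (1 / 2 : ℝ) * Real.log (1 + Ptr i)) :
    ∑ i ∈ Finset.Icc 1 L, Ptr i = ∑ i ∈ Finset.Icc 1 L, Pin i := by
  have hLmem : L ∈ Finset.Icc 1 L := Finset.mem_Icc.2 ⟨hL, le_rfl⟩
  refine le_antisymm (hPtr.2 L hLmem) ?_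
  by_contra! hlt
  set δ := ∑ i ∈ Finset.Icc 1 L, Pin i - ∑ i ∈ Finset.Icc 1 L, Ptr i with hδ
  have hδ_pos : 0 < δ := sub_pos.2 hlt
  -- Spending the unused energy `δ` in the last slot is feasible and strictly better.
  let Q : ℕ → ℝ := fun i => Ptr i + if i = L then δ else 0
  have hle : ∀ i, Ptr i ≤ Q i := fun i =>
    le_add_of_nonneg_right (by split_ifs <;> positivity)
  have hQ : CausalityFeasible L Pin Q := by
    refine ⟨fun i hi => (hPtr.1 i hi).trans (hle i), fun l hl => ?_⟩
    simp only [Q, Finset.sum_add_distrib, Finset.sum_ite_eq']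
    split_ifs with h
    · obtain rfl : l = L := le_antisymm (Finset.mem_Icc.1 hl).2 (Finset.mem_Icc.1 h).2
      linarith
    · simpa using hPtr.2 l hl
  refine (hmax Q hQ).not_gt (Finset.sum_lt_sum (fun i hi => ?_) ⟨L, hLmem, ?_⟩)
  · have := hPtr.1 i hi
    gcongr
    exact hle i
  · have := hPtr.1 L hLmem
    have hlt_last : Ptr L < Q L := by simpa [Q] using hδ_pos
    gcongr
end
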